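/- Let u be a ground state, or a solution of the IVP that changes sign with exactly k zeros z₁ < ⋯ < z_k, and set ω(r) = −r u'(r)/u(r) wherever u(r) ≠ 0. Then ω'(r) > 0 at every point r with u(r) ≠ 0, for all r > 0 if u is decaying, and for all r ∈ (0, z_k] otherwise. -/

import Mathlib

open Real Filter Set

/-- The nonlinearity `f(s) = -s + |s|^(p-1) s`. -/
noncomputable def f (p s : ℝ) : ℝ := -s + |s| ^ (p - 1) * s

/-- The derivative of the nonlinearity, `f'(s) = -1 + p |s|^(p-1)`. -/
noncomputable def fder (p s : ℝ) : ℝ := -1 + p * |s| ^ (p - 1)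

/-- The primitive `F(s) = -s^2/2 + |s|^(p+1)/(p+1)`. -/
noncomputable def F (p s : ℝ) : ℝ := -s ^ 2 / 2 + |s| ^ (p + 1) / (p + 1)

/-- `u : [0,∞) → ℝ` (modeled on `Set.Ici 0`) is a C² solution of the IVP
`u'' + ((n-1)/r) u' + f(u) = 0`, `u(0) = α`, `u'(0) = 0`; the data `u'`, `u''`
are its first and second derivatives on `[0,∞)`. -/
structure IsSolution (n : ℕ) (p α : ℝ) (u u' u'' : ℝ → ℝ) : Prop where
  init : u 0 = α
  initDeriv : u' 0 = 0
  hasDeriv1 : ∀ r ∈ Set.Ici (0:ℝ), HasDerivWithinAt u (u' r) (Set.Ici 0) r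
  hasDeriv2 : ∀ r ∈ Set.Ici (0:ℝ), HasDerivWithinAt u' (u'' r) (Set.Ici 0) r
  cont2 : ContinuousOn u'' (Set.Ici 0)
  ode : ∀ r : ℝ, 0 < r → u'' r + ((n : ℝ) - 1) / r * u' r + f p (u r) = 0

/-- The variation `v` associated with a solution `u`: the C² solution of the linearized
equation `v'' + ((n-1)/r) v' + f'(u) v = 0`, `v(0) = 1`, `v'(0) = 0`. -/
structure IsVariation (n : ℕ) (p : ℝ) (u v v' v'' : ℝ → ℝ) : Prop where
  init : v 0 = 1
  initDeriv : v' 0 = 0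
  hasDeriv1 : ∀ r ∈ Set.Ici (0:ℝ), HasDerivWithinAt v (v' r) (Set.Ici 0) r
  hasDeriv2 : ∀ r ∈ Set.Ici (0:ℝ), HasDerivWithinAt v' (v'' r) (Set.Ici 0) r
  cont2 : ContinuousOn v'' (Set.Ici 0)
  ode : ∀ r : ℝ, 0 < r → v'' r + ((n : ℝ) - 1) / r * v' r + fder p (u r) * v r = 0

/-- `u` is decaying: `u(r) → 0` and `u'(r) → 0` as `r → ∞`. -/
def Decaying (u u' : ℝ → ℝ) : Prop :=
  Filter.Tendsto u Filter.atTop (nhds 0) ∧ Filter.Tendsto u' Filter.atTop (nhds 0)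

/-- `u` changes sign on `(0,∞)`. -/
def ChangesSign (u : ℝ → ℝ) : Prop :=
  (∃ r : ℝ, 0 < r ∧ u r < 0) ∧ (∃ r : ℝ, 0 < r ∧ 0 < u r)

/-- `z 0 < z 1 < ⋯ < z (k-1)` are exactly the zeros of `u` in `(0,∞)`. -/
def ExactZeros (u : ℝ → ℝ) (k : ℕ) (z : Fin k → ℝ) : Prop :=
  StrictMono z ∧ (∀ i, 0 < z i ∧ u (z i) = 0) ∧
    ∀ r : ℝ, 0 < r → u r = 0 → ∃ i, r = z i

/-- The energy `u'^2/2 + F(u)`. -/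
noncomputable def energy (p : ℝ) (u u' : ℝ → ℝ) (r : ℝ) : ℝ := u' r ^ 2 / 2 + F p (u r)

/-- The Pohozaev function `2 r^n E + (n-2) r^(n-1) u u'` in dimension `n = l + 2`. -/
noncomputable def pohozaev (l : ℕ) (p : ℝ) (u u' : ℝ → ℝ) (r : ℝ) : ℝ :=
  r ^ (l + 1) * (2 * r * energy p u u' r + l * (u r * u' r))

lemma abs_rpow_add_one {p : ℝ} (hp : 1 < p) (s : ℝ) : |s| ^ (p + 1) = |s| ^ (p - 1) * s ^ 2 := by
  have h : p + 1 = (p - 1) + (2 : ℕ) := by push_cast; ring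
  rw [h, Real.rpow_add_natCast' (abs_nonneg s) (by push_cast; linarith), sq_abs]

lemma F_eq {p : ℝ} (hp : 1 < p) (s : ℝ) :
    F p s = s ^ 2 * (-1 / 2 + |s| ^ (p - 1) / (p + 1)) := by
  rw [F, abs_rpow_add_one hp]
  ring

lemma hasDerivAt_F {p : ℝ} (hp : 1 < p) (s : ℝ) : HasDerivAt (F p) (f p s) s := by
  have h1 := (hasDerivAt_abs_rpow s (p := p + 1) (by linarith)).div_const (p + 1)
  have h2 := ((hasDerivAt_pow 2 s).fun_neg).div_const 2
  have h3 := h2.fun_add h1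
  have hp' : p + 1 ≠ 0 := by linarith
  refine h3.congr_deriv ?_
  rw [show p + 1 - 2 = p - 1 by ring, f]
  push_cast
  field_simp

namespace IsSolution

variable {n : ℕ} {p α : ℝ} {u u' u'' : ℝ → ℝ}

lemma hasDerivAt_fst (hu : IsSolution n p α u u' u'') {r : ℝ} (hr : 0 < r) :
    HasDerivAt u (u' r) r := (hu.hasDeriv1 r hr.le).hasDerivAt (Ici_mem_nhds hr)

lemma hasDerivAt_snd (hu : IsSolution n p α u u' u'') {r : ℝ} (hr : 0 < r) :
    HasDerivAt u' (u'' r) r := (hu.hasDeriv2 r hr.le).hasDerivAt (Ici_mem_nhds hr)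

lemma continuousOn_fst (hu : IsSolution n p α u u' u'') : ContinuousOn u (Ici 0) :=
  fun r hr => (hu.hasDeriv1 r hr).continuousWithinAt

lemma continuousOn_snd (hu : IsSolution n p α u u' u'') : ContinuousOn u' (Ici 0) :=
  fun r hr => (hu.hasDeriv2 r hr).continuousWithinAt

lemma continuousOn_energy (hu : IsSolution n p α u u' u'') (hp : 1 < p) :
    ContinuousOn (energy p u u') (Ici 0) := by
  have hF : Continuous (F p) :=
    continuous_iff_continuousAt.2 fun s => (hasDerivAt_F hp s).continuousAt
  exact ((hu.continuousOn_snd.pow 2).div_const 2).add (hF.comp_continuousOn hu.continuousOn_fst)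

lemma hasDerivAt_energy (hu : IsSolution n p α u u' u'') (hp : 1 < p) {r : ℝ} (hr : 0 < r) :
    HasDerivAt (energy p u u') (-(((n : ℝ) - 1) / r * u' r ^ 2)) r := by
  have h1 := ((hu.hasDerivAt_snd hr).fun_pow 2).div_const 2
  have h2 := (hasDerivAt_F hp (u r)).comp r (hu.hasDerivAt_fst hr)
  refine (h1.fun_add h2).congr_deriv ?_
  have h3 : u'' r = -(((n : ℝ) - 1) / r * u' r) - f p (u r) := by linarith [hu.ode r hr]
  rw [h3]
  push_cast
  ring

lemma antitoneOn_energy (hu : IsSolution n p α u u' u'') (hn : 1 ≤ n) (hp : 1 < p) :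
    AntitoneOn (energy p u u') (Ici 0) := by
  refine antitoneOn_of_deriv_nonpos (convex_Ici 0) (hu.continuousOn_energy hp) ?_ ?_
  · intro r hr
    rw [interior_Ici] at hr
    exact (hu.hasDerivAt_energy hp hr).differentiableAt.differentiableWithinAt
  · intro r hr
    rw [interior_Ici] at hr
    rw [(hu.hasDerivAt_energy hp hr).deriv]
    have : (0 : ℝ) ≤ (n : ℝ) - 1 := by simpa using hn
    have : 0 ≤ ((n : ℝ) - 1) / r * u' r ^ 2 := by
      have := mem_Ioi.1 hr
      positivity
    linarith

lemma energy_nonneg_of_decaying (hu : IsSolution n p α u u' u'') (hn : 1 ≤ n) (hp : 1 < p)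
    (hd : Decaying u u') {r : ℝ} (hr : 0 ≤ r) : 0 ≤ energy p u u' r := by
  have hlim : Tendsto (energy p u u') atTop (nhds 0) := by
    have h1 := (hd.2.pow 2).div_const 2
    have h2 := ((hasDerivAt_F hp 0).continuousAt.tendsto).comp hd.1
    have h3 := h1.add h2
    have h4 : F p 0 = 0 := by simp [F_eq hp 0]
    rw [h4, show (0 : ℝ) ^ 2 / 2 + 0 = 0 by norm_num] at h3
    exact h3
  refine le_of_tendsto hlim ?_
  filter_upwards [eventually_ge_atTop r] with s hs
  exact hu.antitoneOn_energy hn hp hr (hr.trans hs) hs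

lemma energy_nonneg_of_zero (hu : IsSolution n p α u u' u'') (hn : 1 ≤ n) (hp : 1 < p)
    {r z : ℝ} (hr : 0 ≤ r) (hrz : r ≤ z) (hz : u z = 0) : 0 ≤ energy p u u' r := by
  refine le_trans ?_ (hu.antitoneOn_energy hn hp hr (hr.trans hrz) hrz)
  have : F p (u z) = 0 := by rw [F_eq hp, hz]; simp
  rw [energy, this]
  positivity

lemma hasDerivAt_sq (hu : IsSolution n p α u u' u'') {r : ℝ} (hr : 0 < r) :
    HasDerivAt (fun s => u s ^ 2) (2 * (u r * u' r)) r := by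
  refine ((hu.hasDerivAt_fst hr).fun_pow 2).congr_deriv ?_
  push_cast
  ring

lemma antitoneOn_sq (hu : IsSolution n p α u u' u'') {D : Set ℝ} (hD : Convex ℝ D)
    (hD0 : D ⊆ Ici 0) (h : ∀ r ∈ interior D, u r * u' r < 0) :
    AntitoneOn (fun r => u r ^ 2) D := by
  have hpos : ∀ r ∈ interior D, 0 < r := fun r hr => by
    have := interior_mono hD0 hr
    rwa [interior_Ici] at this
  refine antitoneOn_of_deriv_nonpos hD ((hu.continuousOn_fst.mono hD0).pow 2) ?_ ?_
  · exact fun r hr => (hu.hasDerivAt_sq (hpos r hr)).differentiableAt.differentiableWithinAt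
  · intro r hr
    rw [(hu.hasDerivAt_sq (hpos r hr)).deriv]
    linarith [h r hr]

lemma antitoneOn_abs_rpow (hu : IsSolution n p α u u' u'') (hp : 1 < p) {D : Set ℝ}
    (hD : Convex ℝ D) (hD0 : D ⊆ Ici 0) (h : ∀ r ∈ interior D, u r * u' r < 0) :
    AntitoneOn (fun r => |u r| ^ (p - 1)) D := fun x hx y hy hxy =>
  Real.rpow_le_rpow (abs_nonneg _) (sq_le_sq.1 (hu.antitoneOn_sq hD hD0 h hx hy hxy))
    (by linarith)

variable {l : ℕ}

lemma continuousOn_pohozaev (hu : IsSolution n p α u u' u'') (hp : 1 < p) :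
    ContinuousOn (pohozaev l p u u') (Ici 0) := by
  have h1 := hu.continuousOn_energy hp
  have h2 := hu.continuousOn_fst
  have h3 := hu.continuousOn_snd
  unfold pohozaev
  fun_prop

lemma hasDerivAt_pohozaev (hu : IsSolution (l + 2) p α u u' u'') (hp : 1 < p) {r : ℝ}
    (hr : 0 < r) :
    HasDerivAt (pohozaev l p u u')
      (r ^ (l + 1) * u r ^ 2 * ((2 * (l + 2) / (p + 1) - l) * |u r| ^ (p - 1) - 2)) r := by
  have h1 := hu.hasDerivAt_energy hp hr
  have h2 := (hu.hasDerivAt_fst hr).fun_mul (hu.hasDerivAt_snd hr)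
  have h3 := ((hasDerivAt_id r).const_mul 2).fun_mul h1
  have h4 := (hasDerivAt_pow (l + 1) r).fun_mul (h3.fun_add (h2.const_mul (l : ℝ)))
  have hF := F_eq hp (u r)
  have h5 : u'' r = -((((l + 2 : ℕ) : ℝ) - 1) / r * u' r) - f p (u r) := by
    linarith [hu.ode r hr]
  refine h4.congr_deriv ?_
  simp only [h5, energy, hF, f, id]
  have hp' : p + 1 ≠ 0 := by linarith
  push_cast
  simp only [pow_succ]
  field_simp
  ring

lemma pohozaev_eq_add (hp : 1 < p) (r : ℝ) :
    r ^ (l + 1) * (r * u' r ^ 2 + l * (u r * u' r) + r * (u r * f p (u r))) =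
      pohozaev l p u u' r + r ^ (l + 2) * (|u r| ^ (p - 1) * u r ^ 2 * ((p - 1) / (p + 1))) := by
  have hp' : p + 1 ≠ 0 := by linarith
  simp only [pohozaev, energy, F_eq hp, f]
  field_simp
  ring

lemma pohozaev_nonneg_of_mul_nonneg {r : ℝ} (hr : 0 ≤ r) (hE : 0 ≤ energy p u u' r)
    (h : 0 ≤ u r * u' r) : 0 ≤ pohozaev l p u u' r := by
  unfold pohozaev
  positivity

lemma pohozaev_nonneg_of_large (hu : IsSolution (l + 2) p α u u' u'') (hp : 1 < p)
    (hc : 0 ≤ 2 * ((l : ℝ) + 2) / (p + 1) - l) {r : ℝ} (hr : 0 < r)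
    (hE : ∀ s, 0 ≤ s → s ≤ r → 0 ≤ energy p u u' s)
    (hlarge : 2 ≤ (2 * ((l : ℝ) + 2) / (p + 1) - l) * |u r| ^ (p - 1)) :
    0 ≤ pohozaev l p u u' r := by
  have hsub : Icc 0 r ⊆ Ici (0 : ℝ) := fun x hx => hx.1
  have hcont : ContinuousOn (fun s => u s * u' s) (Icc 0 r) :=
    (hu.continuousOn_fst.mul hu.continuousOn_snd).mono hsub
  have hcpt : IsCompact (Icc 0 r ∩ (fun s => u s * u' s) ⁻¹' Ici 0) :=
    isCompact_Icc.of_isClosed_subset (hcont.preimage_isClosed_of_isClosed isClosed_Icc isClosed_Ici)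
      inter_subset_left
  obtain ⟨a, ⟨⟨ha0, har⟩, ha⟩, hmax⟩ := hcpt.exists_isGreatest
    ⟨0, ⟨le_rfl, hr.le⟩, by simp [hu.initDeriv]⟩
  have hneg : ∀ s ∈ interior (Icc a r), u s * u' s < 0 := by
    intro s hs
    rw [interior_Icc] at hs
    by_contra hcon
    have := hmax ⟨⟨ha0.trans hs.1.le, hs.2.le⟩, not_lt.1 hcon⟩
    linarith [hs.1]
  have hsub' : Icc a r ⊆ Ici 0 := fun x hx => ha0.trans hx.1
  have hanti := hu.antitoneOn_abs_rpow hp (convex_Icc a r) hsub' hneg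
  have hmono : MonotoneOn (pohozaev l p u u') (Icc a r) := by
    have hpos : ∀ s ∈ interior (Icc a r), 0 < s := fun s hs => by
      rw [interior_Icc] at hs
      linarith [hs.1]
    refine monotoneOn_of_deriv_nonneg (convex_Icc a r) ((hu.continuousOn_pohozaev hp).mono hsub')
      (fun s hs => (hu.hasDerivAt_pohozaev hp (hpos s hs)).differentiableAt.differentiableWithinAt)
      fun s hs => ?_
    rw [(hu.hasDerivAt_pohozaev hp (hpos s hs)).deriv]
    have h1 := mul_le_mul_of_nonneg_left
      (hanti (interior_subset hs) ⟨har, le_rfl⟩ (interior_subset hs).2) hc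
    have := hpos s hs
    exact mul_nonneg (by positivity) (by linarith)
  exact (pohozaev_nonneg_of_mul_nonneg ha0 (hE a ha0 har) ha).trans
    (hmono ⟨le_rfl, har⟩ ⟨har, le_rfl⟩ har)

lemma pohozaev_le_of_small (hu : IsSolution (l + 2) p α u u' u'') (hp : 1 < p)
    (hc : 0 ≤ 2 * ((l : ℝ) + 2) / (p + 1) - l) {r b : ℝ} (hr : 0 < r) (hrb : r ≤ b)
    (hneg : ∀ s ∈ Ioo r b, u s * u' s < 0)
    (hsmall : (2 * ((l : ℝ) + 2) / (p + 1) - l) * |u r| ^ (p - 1) ≤ 2) :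
    pohozaev l p u u' b ≤ pohozaev l p u u' r := by
  rw [← interior_Icc] at hneg
  have hsub : Icc r b ⊆ Ici 0 := fun x hx => hr.le.trans hx.1
  have hanti := hu.antitoneOn_abs_rpow hp (convex_Icc r b) hsub hneg
  have hpos : ∀ s ∈ interior (Icc r b), 0 < s := fun s hs => hr.trans_le (interior_subset hs).1
  refine antitoneOn_of_deriv_nonpos (convex_Icc r b) ((hu.continuousOn_pohozaev hp).mono hsub)
    (fun s hs => (hu.hasDerivAt_pohozaev hp (hpos s hs)).differentiableAt.differentiableWithinAt)
    (fun s hs => ?_) ⟨le_rfl, hrb⟩ ⟨hrb, le_rfl⟩ hrb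
  rw [(hu.hasDerivAt_pohozaev hp (hpos s hs)).deriv]
  have h1 := mul_le_mul_of_nonneg_left
    (hanti ⟨le_rfl, hrb⟩ (interior_subset hs) (interior_subset hs).1) hc
  have := hpos s hs
  exact mul_nonpos_of_nonneg_of_nonpos (by positivity) (by linarith)

lemma pohozaev_nonneg_of_small (hu : IsSolution (l + 2) p α u u' u'') (hp : 1 < p)
    (hc : 0 ≤ 2 * ((l : ℝ) + 2) / (p + 1) - l) {r c : ℝ} (hr : 0 < r) (hrc : r ≤ c)
    (huc : 0 ≤ u c * u' c) (hE : ∀ s, 0 ≤ s → s ≤ c → 0 ≤ energy p u u' s)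
    (hsmall : (2 * ((l : ℝ) + 2) / (p + 1) - l) * |u r| ^ (p - 1) ≤ 2) :
    0 ≤ pohozaev l p u u' r := by
  have hsub : Icc r c ⊆ Ici (0 : ℝ) := fun x hx => hr.le.trans hx.1
  have hcont : ContinuousOn (fun s => u s * u' s) (Icc r c) :=
    (hu.continuousOn_fst.mul hu.continuousOn_snd).mono hsub
  have hcpt : IsCompact (Icc r c ∩ (fun s => u s * u' s) ⁻¹' Ici 0) :=
    isCompact_Icc.of_isClosed_subset (hcont.preimage_isClosed_of_isClosed isClosed_Icc isClosed_Ici)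
      inter_subset_left
  obtain ⟨b, ⟨⟨hrb, hbc⟩, hb⟩, hmin⟩ := hcpt.exists_isLeast ⟨c, ⟨hrc, le_rfl⟩, huc⟩
  have hneg : ∀ s ∈ Ioo r b, u s * u' s < 0 := by
    intro s hs
    by_contra hcon
    have := hmin ⟨⟨hs.1.le, hs.2.le.trans hbc⟩, not_lt.1 hcon⟩
    linarith [hs.2]
  have hb0 := hr.le.trans hrb
  exact (pohozaev_nonneg_of_mul_nonneg hb0 (hE b hb0 hbc) hb).trans
    (hu.pohozaev_le_of_small hp hc hr hrb hneg hsmall)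

lemma exists_sq_le_exp (hu : IsSolution n p α u u' u'') (hp : 1 < p)
    (hd : Tendsto u atTop (nhds 0)) (hE : ∀ s, 0 ≤ s → 0 ≤ energy p u u' s) {r : ℝ} (hr : 0 < r)
    (hneg : ∀ s, r ≤ s → u s * u' s < 0) :
    ∃ C : ℝ, ∀ᶠ s in atTop, u s ^ 2 ≤ C * exp (-s) := by
  have hT : Tendsto (fun s => |u s| ^ (p - 1)) atTop (nhds 0) := by
    have := hd.abs.rpow_const (p := p - 1) (Or.inr (by linarith))
    rwa [abs_zero, Real.zero_rpow (by linarith)] at this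
  obtain ⟨M, hM⟩ := eventually_atTop.1 (hT.eventually_le_const (show (0 : ℝ) < 3 / 4 by norm_num))
  have hineq : ∀ s, max r M ≤ s → u s * u' s ≤ -(u s ^ 2 / 2) := by
    intro s hs
    have hrs := (le_max_left _ _).trans hs
    have h1 := hE s (hr.le.trans hrs)
    have h2 := hM s ((le_max_right _ _).trans hs)
    have h3 := hneg s hrs
    rw [energy, F_eq hp] at h1
    have h4 : |u s| ^ (p - 1) / (p + 1) ≤ 3 / 8 := by
      rw [div_le_iff₀ (by linarith)]
      linarith
    have h5 := mul_le_mul_of_nonneg_left h4 (sq_nonneg (u s))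
    have h6 : u s ^ 2 / 4 ≤ u' s ^ 2 := by linarith
    have h7 : (u s ^ 2 / 2) ^ 2 ≤ (-(u s * u' s)) ^ 2 := by
      nlinarith [mul_le_mul_of_nonneg_left h6 (sq_nonneg (u s))]
    linarith [(sq_le_sq₀ (by positivity) (by linarith)).1 h7]
  have hpos : ∀ s, max r M ≤ s → 0 < s := fun s hs => hr.trans_le ((le_max_left _ _).trans hs)
  have hder : ∀ s, max r M ≤ s → HasDerivAt (fun t => u t ^ 2 * exp t)
      (2 * (u s * u' s) * exp s + u s ^ 2 * exp s) s := fun s hs =>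
    (hu.hasDerivAt_sq (hpos s hs)).fun_mul (Real.hasDerivAt_exp s)
  have hanti : AntitoneOn (fun t => u t ^ 2 * exp t) (Ici (max r M)) := by
    refine antitoneOn_of_deriv_nonpos (convex_Ici _)
      (fun s hs => (hder s hs).continuousAt.continuousWithinAt)
      (fun s hs => (hder s (interior_subset hs)).differentiableAt.differentiableWithinAt)
      fun s hs => ?_
    rw [(hder s (interior_subset hs)).deriv]
    nlinarith [hineq s (interior_subset hs), exp_pos s]
  refine ⟨u (max r M) ^ 2 * exp (max r M), ?_⟩
  filter_upwards [eventually_ge_atTop (max r M)] with s hs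
  have := hanti (mem_Ici.2 le_rfl) hs hs
  rw [Real.exp_neg, ← div_eq_mul_inv, le_div_iff₀ (exp_pos s)]
  exact this

lemma tendsto_pow_mul_mul (hu : IsSolution n p α u u' u'') (hp : 1 < p)
    (hd : Decaying u u') (hE : ∀ s, 0 ≤ s → 0 ≤ energy p u u' s) {r : ℝ} (hr : 0 < r)
    (hneg : ∀ s, r ≤ s → u s * u' s < 0) (k : ℕ) :
    Tendsto (fun s => s ^ k * (u s * u' s)) atTop (nhds 0) := by
  obtain ⟨C, hC⟩ := hu.exists_sq_le_exp hp hd.1 hE hr hneg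
  have h1 : Tendsto (fun s => (s ^ k * u s) ^ 2) atTop (nhds 0) := by
    have h2 := (Real.tendsto_pow_mul_exp_neg_atTop_nhds_zero (k * 2)).const_mul C
    rw [mul_zero] at h2
    refine squeeze_zero' (Eventually.of_forall fun s => sq_nonneg _) ?_ h2
    filter_upwards [hC] with s hs
    have h3 := mul_le_mul_of_nonneg_left hs (sq_nonneg (s ^ k))
    rw [mul_pow, pow_mul]
    linarith
  have h4 : Tendsto (fun s => s ^ k * u s) atTop (nhds 0) := by
    rw [tendsto_zero_iff_abs_tendsto_zero, Function.comp_def]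
    have := h1.sqrt
    simpa only [Real.sqrt_sq_eq_abs, Real.sqrt_zero] using this
  have := h4.mul hd.2
  simpa only [mul_zero, mul_assoc] using this

lemma pohozaev_nonneg_of_tail (hu : IsSolution (l + 2) p α u u' u'') (hp : 1 < p)
    (hc : 0 ≤ 2 * ((l : ℝ) + 2) / (p + 1) - l) (hd : Decaying u u')
    (hE : ∀ s, 0 ≤ s → 0 ≤ energy p u u' s) {r : ℝ} (hr : 0 < r)
    (hneg : ∀ s, r ≤ s → u s * u' s < 0)
    (hsmall : (2 * ((l : ℝ) + 2) / (p + 1) - l) * |u r| ^ (p - 1) ≤ 2) :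
    0 ≤ pohozaev l p u u' r := by
  have hlim := (hu.tendsto_pow_mul_mul hp hd hE hr hneg (l + 1)).const_mul (l : ℝ)
  rw [mul_zero] at hlim
  refine le_of_tendsto hlim ?_
  filter_upwards [eventually_ge_atTop r] with s hs
  refine le_trans ?_ (hu.pohozaev_le_of_small hp hc hr hs (fun t ht => hneg t ht.1.le) hsmall)
  have hs0 := hr.le.trans hs
  have := hE s hs0
  have : 0 ≤ s ^ (l + 1) * (2 * s * energy p u u' s) := by positivity
  rw [pohozaev]
  linarith

lemma pohozaev_nonneg (hu : IsSolution (l + 2) p α u u' u'') (hp : 1 < p)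
    (hc : 0 ≤ 2 * ((l : ℝ) + 2) / (p + 1) - l) {r : ℝ} (hr : 0 < r)
    (h : Decaying u u' ∨ ∃ z, r ≤ z ∧ u z = 0) : 0 ≤ pohozaev l p u u' r := by
  rcases le_total 2 ((2 * ((l : ℝ) + 2) / (p + 1) - l) * |u r| ^ (p - 1)) with hT | hT
  · refine hu.pohozaev_nonneg_of_large hp hc hr (fun s hs hsr => ?_) hT
    rcases h with hd | ⟨z, hrz, hz⟩
    · exact hu.energy_nonneg_of_decaying (by omega) hp hd hs
    · exact hu.energy_nonneg_of_zero (by omega) hp hs (hsr.trans hrz) hz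
  · rcases h with hd | ⟨z, hrz, hz⟩
    · have hE : ∀ s, 0 ≤ s → 0 ≤ energy p u u' s := fun s hs =>
        hu.energy_nonneg_of_decaying (by omega) hp hd hs
      by_cases hex : ∃ c, r ≤ c ∧ 0 ≤ u c * u' c
      · obtain ⟨c, hrc, huc⟩ := hex
        exact hu.pohozaev_nonneg_of_small hp hc hr hrc huc (fun s hs _ => hE s hs) hT
      · push Not at hex
        exact hu.pohozaev_nonneg_of_tail hp hc hd hE hr hex hT
    · exact hu.pohozaev_nonneg_of_small hp hc hr hrz (by simp [hz])
        (fun s hs hsz => hu.energy_nonneg_of_zero (by omega) hp hs hsz hz) hT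

end IsSolution

/-- the function `ω(r) = -r u'(r)/u(r)` is strictly increasing wherever
`u(r) ≠ 0` — on all of `(0,∞)` if `u` is decaying, and on `(0, z_k]` otherwise. -/
theorem statement14 (n : ℕ) (hn : 3 ≤ n) (p : ℝ) (hp1 : 1 < p)
    (hp2 : p < ((n : ℝ) + 2) / ((n : ℝ) - 2))
    (α : ℝ) (hα : 0 < α)
    (u u' u'' : ℝ → ℝ) (hu : IsSolution n p α u u' u'')
    (k : ℕ) (hk : 0 < k) (z : Fin k → ℝ)
    (hcase : (Decaying u u' ∧ ∀ r : ℝ, 0 ≤ r → 0 < u r) ∨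
             (ChangesSign u ∧ ExactZeros u k z)) :
    ∀ r : ℝ, 0 < r → (Decaying u u' ∨ r ≤ z ⟨k - 1, by omega⟩) → u r ≠ 0 →
      ∃ d : ℝ, HasDerivWithinAt (fun s => -(s * u' s) / u s) d (Set.Ici 0) r ∧ 0 < d := by
  intro r hr hrz hur
  obtain ⟨l, rfl⟩ : ∃ l, n = l + 2 := ⟨n - 2, by omega⟩
  have hl : (0 : ℝ) < l := by exact_mod_cast (by omega : 0 < l)
  have hc : 0 ≤ 2 * ((l : ℝ) + 2) / (p + 1) - l := by
    push_cast at hp2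
    rw [add_sub_cancel_right, lt_div_iff₀ hl] at hp2
    rw [sub_nonneg, le_div_iff₀ (by linarith)]
    linarith
  have h : Decaying u u' ∨ ∃ z, r ≤ z ∧ u z = 0 := by
    rcases hcase with ⟨hd, -⟩ | ⟨-, hz⟩
    · exact Or.inl hd
    · exact hrz.imp_right fun hr' => ⟨_, hr', (hz.2.1 _).2⟩
  have hQ := hu.pohozaev_nonneg hp1 hc hr h
  have hG : 0 < r * u' r ^ 2 + l * (u r * u' r) + r * (u r * f p (u r)) := by
    have habs : 0 < |u r| := abs_pos.2 hur
    have hp' : 0 < p - 1 := by linarith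
    have hpos : 0 < r ^ (l + 2) * (|u r| ^ (p - 1) * u r ^ 2 * ((p - 1) / (p + 1))) := by
      positivity
    have := IsSolution.pohozaev_eq_add (l := l) (u := u) (u' := u') hp1 r
    exact pos_of_mul_pos_right (by linarith) (pow_nonneg hr.le (l + 1))
  refine ⟨(r * u' r ^ 2 + l * (u r * u' r) + r * (u r * f p (u r))) / u r ^ 2, ?_, by positivity⟩
  have hder := (((hasDerivAt_id r).fun_mul (hu.hasDerivAt_snd hr)).fun_neg).fun_div
    (hu.hasDerivAt_fst hr) hur
  refine (hder.congr_deriv ?_).hasDerivWithinAt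
  have h5 : u'' r = -((((l + 2 : ℕ) : ℝ) - 1) / r * u' r) - f p (u r) := by
    linarith [hu.ode r hr]
  simp only [h5, id]
  push_cast
  field_simp
  ring
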